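/- Let g ∈ ℤ[x] be x²-divisible of degree d ≥ 3 and let α ∈ [−4L_g, 4L_g] be a real number such that g(x) ≠ u_d x^d or α ≠ 0. Then there exists δ with 0 < δ < L_g such that g has rapidly increasing numerators on (α−δ, α+δ) ∩ 𝕌_g. -/

import Mathlib

open Polynomial

/-- The `n`-th iterate of `g_c := g + c` applied to `0`, for `g ∈ ℤ[x]` and `c ∈ ℚ`. -/
noncomputable def gcIter (g : ℤ[X]) (c : ℚ) (n : ℕ) : ℚ :=
  (fun x : ℚ => (g.map (Int.castRingHom ℚ)).eval x + c)^[n] 0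

/-- `g` is `x²`-divisible: degree at least 2 and zero constant and linear coefficients. -/
def IsX2Divisible (g : ℤ[X]) : Prop :=
  2 ≤ g.natDegree ∧ g.coeff 0 = 0 ∧ g.coeff 1 = 0

/-- The length `L_g = 1 + ∑_{i=2}^{d-1} |u_i|/|u_d|` of an `x²`-divisible polynomial. -/
noncomputable def Lg (g : ℤ[X]) : ℝ :=
  1 + ∑ i ∈ Finset.Ico 2 g.natDegree, (|g.coeff i| : ℝ) / (|g.leadingCoeff| : ℝ)

/-- `S_g`: the set of `c ∈ ℚ` such that the sequence `{g_c^n(0)}_{n ≥ 1}` takes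
infinitely many values. -/
def Sg (g : ℤ[X]) : Set ℚ :=
  {c : ℚ | (Set.range fun n : ℕ => gcIter g c (n + 1)).Infinite}

/-- The numerator `A_n` of `g_c^{n+1}(0) = g_c^n(c) = A_n / B_n` in lowest terms. -/
noncomputable def An (g : ℤ[X]) (c : ℚ) (n : ℕ) : ℤ := (gcIter g c (n + 1)).num

/-- The (positive) denominator `B_n` of `g_c^{n+1}(0) = g_c^n(c) = A_n / B_n`
in lowest terms. -/
noncomputable def Bn (g : ℤ[X]) (c : ℚ) (n : ℕ) : ℕ := (gcIter g c (n + 1)).den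

/-- For a natural number `a`, the factor `â = ∏_{p ∈ I(a)} p^{val_p(a)}`, where
`I(a)` consists of the primes `p` with `val_p(a) > val_p(u_d)`. -/
noncomputable def hatB (g : ℤ[X]) (a : ℕ) : ℕ :=
  ∏ p ∈ a.primeFactors.filter
      (fun p => padicValInt p g.leadingCoeff < padicValNat p a),
    p ^ padicValNat p a

/-- `g` has rapidly increasing numerators on `S`: there is an integer `N > 0` such that
for every `c ∈ S` there is a finite set `J_c ⊆ ℕ` with `#J_c ≤ N` such that for every
`n ≥ 1` outside `J_c` one has `ln |A_n| > ∑_{p ∣ n} ln |A_{n/p}|`. -/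
def RapidlyIncreasingNumerators (g : ℤ[X]) (S : Set ℚ) : Prop :=
  ∃ N : ℕ, 0 < N ∧ ∀ c ∈ S, ∃ J : Finset ℕ, J.card ≤ N ∧
    ∀ n : ℕ, 1 ≤ n → n ∉ J →
      (∑ p ∈ n.primeFactors, Real.log |(An g c (n / p) : ℝ)|) <
        Real.log |(An g c n : ℝ)|

/-- `𝕌_g⁰`: the set of `c ∈ S_g ∩ [−4L_g, 4L_g]` whose reduced denominator divides
the leading coefficient `u_d`. -/
def Ug0 (g : ℤ[X]) : Set ℚ :=
  {c : ℚ | c ∈ Sg g ∧ |(c : ℝ)| ≤ 4 * Lg g ∧ (c.den : ℤ) ∣ g.leadingCoeff}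

/-- `𝕌_g = [−4L_g, 4L_g] ∩ (S_g \ 𝕌_g⁰)`. -/
def Ug (g : ℤ[X]) : Set ℚ :=
  {c : ℚ | |(c : ℝ)| ≤ 4 * Lg g} ∩ (Sg g \ Ug0 g)


/-- A sequence `z` obtained by iterating a map with a critical point at `0` is either far from
`0`, or close to it only along multiples of the time `k` of its first close return to `0`. -/
theorem exists_first_close_return (f : ℚ → ℚ) (K R : ℚ) (hK : 1 ≤ K) (hR : 1 ≤ R)
    (hlip : ∀ x y, |x| ≤ R + 1 → |y| ≤ R + 1 → |f x - f y| ≤ K * |x - y|)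
    (hquad : ∀ x, |x| ≤ 1 → |f x - f 0| ≤ K * x ^ 2)
    (hesc : ∀ x, R < |x| → R < |f x|)
    (z : ℕ → ℚ) (z_zero : z 0 = 0) (z_succ : ∀ n, z (n + 1) = f (z n)) :
    ∃ k, 1 ≤ k ∧ ∀ n, 1 ≤ n →
      1 / (16 * K ^ n) ≤ |z n| ∨ n = k ∨ (2 * k ≤ n ∧ |z k| / 2 ≤ |z n|) := by
  have hKpos : 0 < K := by linarith
  by_cases hex : ∃ k, 1 ≤ k ∧ |z k| ≤ 1 / (8 * K ^ k)
  swap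
  · push Not at hex
    refine ⟨1, le_rfl, fun n hn => Or.inl ((le_of_lt (hex n hn)).trans' ?_)⟩
    gcongr
    norm_num
  classical
  obtain ⟨k, ⟨hk1, hk⟩, hmin⟩ : ∃ k, (1 ≤ k ∧ |z k| ≤ 1 / (8 * K ^ k)) ∧
      ∀ i < k, ¬ (1 ≤ i ∧ |z i| ≤ 1 / (8 * K ^ i)) :=
    ⟨Nat.find hex, Nat.find_spec hex, fun i hi => Nat.find_min hex hi⟩
  have hKk : ∀ i, 1 ≤ K ^ i := fun i => one_le_pow₀ hK
  have hzk : 8 * (K ^ k * |z k|) ≤ 1 := by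
    rw [le_div_iff₀ (by have := hKk k; linarith)] at hk
    linarith
  have hzk8 : |z k| ≤ 1 / 8 := by
    nlinarith [hKk k, abs_nonneg (z k)]
  have hbdd : ∀ i ≤ k, |z i| ≤ R := by
    intro i hi
    by_contra! h
    have : ∀ j, R < |z (i + j)| := by
      intro j
      induction j with
      | zero => exact h
      | succ j ih => rw [← add_assoc, z_succ]; exact hesc _ ih
    have := this (k - i)
    rw [Nat.add_sub_cancel' hi] at this
    linarith
  have hstep : ∀ m, |z m| ≤ 2 * |z k| → ∀ i, 1 ≤ i → i ≤ k →
      |z (m + i) - z i| ≤ K ^ i * (4 * |z k| ^ 2) := by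
    intro m hm i hi
    induction i, hi using Nat.le_induction with
    | base =>
      intro _
      rw [z_succ, z_succ 0, z_zero, pow_one]
      refine (hquad _ (by linarith)).trans ?_
      gcongr
      rw [← sq_abs]
      nlinarith [abs_nonneg (z m)]
    | succ i hi ih =>
      intro hik
      have ih := ih (by omega)
      rw [← add_assoc, z_succ, z_succ i]
      have h1 : K ^ i * (4 * |z k| ^ 2) ≤ 1 := by
        have : K ^ i ≤ K ^ k := pow_le_pow_right₀ hK (by omega)
        have h2 : K ^ i * |z k| ≤ K ^ k * |z k| := by gcongr
        nlinarith [abs_nonneg (z k)]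
      have h3 := hbdd i (by omega)
      have h4 : |z (m + i)| ≤ R + 1 := by
        have := abs_add_le (z (m + i) - z i) (z i)
        rw [sub_add_cancel] at this
        linarith
      refine (hlip _ _ h4 (by linarith)).trans ?_
      rw [pow_succ' K i, mul_assoc]
      gcongr
  have hret : ∀ j, |z ((j + 1) * k) - z k| ≤ |z k| / 2 := by
    intro j
    induction j with
    | zero => simp only [zero_add, one_mul, sub_self, abs_zero]; positivity
    | succ j ih =>
      have h1 : |z ((j + 1) * k)| ≤ 2 * |z k| := by
        have := abs_add_le (z ((j + 1) * k) - z k) (z k)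
        rw [sub_add_cancel] at this
        linarith [abs_nonneg (z k)]
      have := hstep _ h1 k hk1 le_rfl
      rw [add_mul (j + 1), one_mul]
      refine this.trans ?_
      nlinarith [abs_nonneg (z k)]
  refine ⟨k, hk1, fun n hn => ?_⟩
  obtain ⟨j, i, hi, rfl⟩ : ∃ j i, i < k ∧ n = j * k + i :=
    ⟨n / k, n % k, Nat.mod_lt _ (by omega), (Nat.div_add_mod' n k).symm⟩
  rcases Nat.eq_zero_or_pos i with rfl | hi0
  · right
    rcases j with _ | _ | j
    · simp at hn
    · simp
    · right
      refine ⟨by nlinarith, ?_⟩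
      have h1 := hret (j + 1)
      rw [abs_sub_comm] at h1
      have := abs_sub_abs_le_abs_sub (z k) (z ((j + 1 + 1) * k))
      rw [add_zero]
      linarith
  · left
    have hfar : 1 / (8 * K ^ i) < |z i| := by
      have := hmin i hi
      push Not at this
      exact this hi0
    have hnear : |z (j * k + i) - z i| ≤ 1 / (16 * K ^ i) := by
      rcases j with _ | j
      · simp only [zero_mul, zero_add, sub_self, abs_zero]
        positivity
      have h1 : |z ((j + 1) * k)| ≤ 2 * |z k| := by
        have := abs_add_le (z ((j + 1) * k) - z k) (z k)
        rw [sub_add_cancel] at this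
        linarith [abs_nonneg (z k), hret j]
      refine (hstep _ h1 i hi0 hi.le).trans ?_
      rw [le_div_iff₀ (by have := hKk i; linarith)]
      have h2 : K ^ i * |z k| ≤ 1 / 8 := by
        have : K ^ i * |z k| ≤ K ^ k * |z k| := by
          gcongr
        linarith
      have h3 : 0 ≤ K ^ i * |z k| := by positivity
      calc K ^ i * (4 * |z k| ^ 2) * (16 * K ^ i) = 64 * (K ^ i * |z k|) ^ 2 := by ring
        _ ≤ 64 * (1 / 8) ^ 2 := by gcongr
        _ = 1 := by norm_num
    have h5 : 1 / (16 * K ^ (j * k + i)) ≤ 1 / (16 * K ^ i) := by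
      gcongr
      · omega
    have h6 : 1 / (8 * K ^ i) = 2 * (1 / (16 * K ^ i)) := by
      field_simp
      norm_num
    have := abs_sub_abs_le_abs_sub (z i) (z (j * k + i))
    rw [abs_sub_comm] at this
    linarith

theorem gcIter_succ (g : ℤ[X]) (c : ℚ) (n : ℕ) :
    gcIter g c (n + 1) = (g.map (Int.castRingHom ℚ)).eval (gcIter g c n) + c :=
  Function.iterate_succ_apply' _ _ _

theorem gcIter_one {g : ℤ[X]} (h0 : g.coeff 0 = 0) (c : ℚ) : gcIter g c 1 = c := by
  rw [gcIter_succ]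
  simp [gcIter, ← Polynomial.coeff_zero_eq_eval_zero, h0]

theorem eval_map_eq_sum (g : ℤ[X]) (x : ℚ) :
    (g.map (Int.castRingHom ℚ)).eval x =
      (∑ i ∈ Finset.range g.natDegree, (g.coeff i : ℚ) * x ^ i) +
        g.leadingCoeff * x ^ g.natDegree := by
  rw [Polynomial.eval_map, Polynomial.eval₂_eq_sum_range, Finset.sum_range_succ]
  rfl

theorem padicNorm_pow (p : ℕ) [Fact p.Prime] (x : ℚ) (n : ℕ) :
    padicNorm p (x ^ n) = padicNorm p x ^ n :=
  IsAbsoluteValue.abv_pow (padicNorm p) x n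

/-- At a point where the leading term dominates `p`-adically, `g` has the norm of that term. -/
theorem padicNorm_eval_eq (p : ℕ) [Fact p.Prime] {g : ℤ[X]} (hd : g.natDegree ≠ 0) {x : ℚ}
    (hx : 1 < padicNorm p g.leadingCoeff * padicNorm p x) :
    padicNorm p ((g.map (Int.castRingHom ℚ)).eval x) =
      padicNorm p g.leadingCoeff * padicNorm p x ^ g.natDegree := by
  have hu : padicNorm p g.leadingCoeff ≤ 1 := padicNorm.of_int _
  have hx0 : 0 ≤ padicNorm p x := padicNorm.nonneg x
  have hx1 : 1 ≤ padicNorm p x := by nlinarith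
  obtain ⟨e, he⟩ := Nat.exists_eq_succ_of_ne_zero hd
  have hlow : padicNorm p (∑ i ∈ Finset.range g.natDegree, (g.coeff i : ℚ) * x ^ i) <
      padicNorm p (g.leadingCoeff * x ^ g.natDegree) := by
    rw [padicNorm.mul, padicNorm_pow]
    have hlt : padicNorm p x ^ e < padicNorm p g.leadingCoeff * padicNorm p x ^ g.natDegree := by
      rw [he, pow_succ]
      nlinarith [one_le_pow₀ hx1 (n := e)]
    refine padicNorm.sum_lt' (fun i hi => hlt.trans_le' ?_) (hlt.trans_le' (by positivity))
    rw [padicNorm.mul, padicNorm_pow]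
    have hi' : i ≤ e := by
      have := Finset.mem_range.mp hi
      omega
    calc padicNorm p (g.coeff i : ℚ) * padicNorm p x ^ i
        ≤ 1 * padicNorm p x ^ e := by
          gcongr
          exact padicNorm.of_int _
      _ = _ := one_mul _
  rw [eval_map_eq_sum, padicNorm.add_eq_max_of_ne hlow.ne, max_eq_right hlow.le,
    padicNorm.mul, padicNorm_pow]

/-- Growth of the `p`-adic norm of the critical orbit when the leading term dominates at `c`. -/
theorem padicNorm_pow_le_sq_gcIter (p : ℕ) [Fact p.Prime] {g : ℤ[X]} (h0 : g.coeff 0 = 0)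
    (hd : 3 ≤ g.natDegree) {c : ℚ} (hc : 1 < padicNorm p g.leadingCoeff * padicNorm p c) (n : ℕ) :
    padicNorm p c ^ g.natDegree ^ n ≤ padicNorm p (gcIter g c (n + 1)) ^ 2 := by
  set u := padicNorm p g.leadingCoeff with hu_def
  set q := padicNorm p c with hq_def
  have hu : u ≤ 1 := padicNorm.of_int _
  have hu0 : 0 ≤ u := padicNorm.nonneg _
  have hq0 : 0 ≤ q := padicNorm.nonneg _
  have hq1 : 1 < q := by nlinarith
  have key : ∀ n, q ≤ padicNorm p (gcIter g c (n + 1)) ∧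
      q ^ g.natDegree ^ n ≤ u * padicNorm p (gcIter g c (n + 1)) ^ 2 := by
    intro n
    induction n with
    | zero =>
      rw [zero_add, gcIter_one h0, pow_zero, pow_one, ← hq_def]
      exact ⟨le_rfl, by nlinarith⟩
    | succ n ih =>
      obtain ⟨h1, h2⟩ := ih
      set r := padicNorm p (gcIter g c (n + 1)) with hr
      have hur : 1 < u * r := hc.trans_le (by gcongr)
      have hr1 : 1 ≤ r := by linarith
      obtain ⟨e, he⟩ := Nat.exists_eq_add_of_le hd
      have heval : padicNorm p ((g.map (Int.castRingHom ℚ)).eval (gcIter g c (n + 1))) =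
          u * r ^ g.natDegree := padicNorm_eval_eq p (by omega) hur
      have hgt : r < u * r ^ g.natDegree := by
        calc r < (u * r) * r := by nlinarith
          _ = u * r ^ 2 := by ring
          _ ≤ u * r ^ g.natDegree := by
            gcongr
            omega
      have hnorm : padicNorm p (gcIter g c (n + 1 + 1)) = u * r ^ g.natDegree := by
        rw [gcIter_succ, padicNorm.add_eq_max_of_ne, heval, max_eq_left]
        · exact h1.trans hgt.le
        · rw [heval]
          exact (h1.trans_lt hgt).ne'
      rw [hnorm]
      refine ⟨h1.trans hgt.le, ?_⟩
      calc q ^ g.natDegree ^ (n + 1) = (q ^ g.natDegree ^ n) ^ g.natDegree := by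
            rw [← pow_mul, pow_succ]
        _ ≤ (u * r ^ 2) ^ g.natDegree := by gcongr
        _ = u ^ e * (u ^ 3 * (r ^ 2) ^ g.natDegree) := by rw [mul_pow, he]; ring
        _ ≤ 1 * (u ^ 3 * (r ^ 2) ^ g.natDegree) := by
            gcongr
            exact pow_le_one₀ hu0 hu
        _ = u * (u * r ^ g.natDegree) ^ 2 := by ring
  refine (key n).2.trans ?_
  nlinarith [sq_nonneg (padicNorm p (gcIter g c (n + 1)))]

theorem padicNorm_mul_den (p : ℕ) [Fact p.Prime] (x : ℚ) :
    padicNorm p x * padicNorm p x.den = padicNorm p x.num := by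
  rw [← padicNorm.mul, Rat.mul_den_eq_num]

theorem padicNorm_num_eq_one (p : ℕ) [hp : Fact p.Prime] {x : ℚ} (h : p ∣ x.den) :
    padicNorm p x.num = 1 := by
  rw [padicNorm.int_eq_one_iff, Int.natCast_dvd]
  intro h'
  have := Nat.dvd_gcd h' h
  rw [x.reduced] at this
  exact hp.out.one_lt.ne' (Nat.dvd_one.mp this)

theorem padicNorm_Bn_sq_le (p : ℕ) [Fact p.Prime] {g : ℤ[X]} (h0 : g.coeff 0 = 0)
    (hd : 3 ≤ g.natDegree) {c : ℚ} (hc : padicNorm p c.den < padicNorm p g.leadingCoeff) (n : ℕ) :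
    padicNorm p (Bn g c n) ^ 2 ≤ padicNorm p c.den ^ g.natDegree ^ n := by
  have hu : padicNorm p g.leadingCoeff ≤ 1 := padicNorm.of_int _
  have hb0 : 0 ≤ padicNorm p c.den := padicNorm.nonneg _
  have hdvd : p ∣ c.den := by
    by_contra h
    rw [← padicNorm.nat_eq_one_iff] at h
    linarith
  have hcb : padicNorm p c * padicNorm p c.den = 1 := by
    rw [padicNorm_mul_den, padicNorm_num_eq_one p hdvd]
  have hc0 : 0 < padicNorm p c :=
    (padicNorm.nonneg c).lt_of_ne fun h => by rw [← h] at hcb; simp at hcb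
  have h1 : 1 < padicNorm p g.leadingCoeff * padicNorm p c := by nlinarith
  have h2 := padicNorm_pow_le_sq_gcIter p h0 hd h1 n
  have h3 : padicNorm p (gcIter g c (n + 1)) * padicNorm p (Bn g c n) ≤ 1 := by
    rw [Bn, padicNorm_mul_den]
    exact padicNorm.of_int _
  have hB0 : 0 ≤ padicNorm p (Bn g c n) := padicNorm.nonneg _
  have hx0 : 0 ≤ padicNorm p (gcIter g c (n + 1)) := padicNorm.nonneg _
  calc padicNorm p (Bn g c n) ^ 2
      = padicNorm p c.den ^ g.natDegree ^ n *
        (padicNorm p c ^ g.natDegree ^ n * padicNorm p (Bn g c n) ^ 2) := by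
        rw [← mul_assoc, ← mul_pow, mul_comm (padicNorm p c.den), hcb, one_pow, one_mul]
    _ ≤ padicNorm p c.den ^ g.natDegree ^ n *
        (padicNorm p (gcIter g c (n + 1)) ^ 2 * padicNorm p (Bn g c n) ^ 2) := by gcongr
    _ = padicNorm p c.den ^ g.natDegree ^ n *
        (padicNorm p (gcIter g c (n + 1)) * padicNorm p (Bn g c n)) ^ 2 := by rw [mul_pow]
    _ ≤ padicNorm p c.den ^ g.natDegree ^ n * 1 := by
        gcongr
        exact pow_le_one₀ (by positivity) h3
    _ = _ := mul_one _

theorem Int.dvd_of_forall_padicNorm_le {a b : ℤ}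
    (h : ∀ (p : ℕ) [Fact p.Prime], padicNorm p a ≤ padicNorm p b) : b ∣ a := by
  rw [← Int.natAbs_dvd_natAbs, Nat.dvd_iff_prime_pow_dvd_dvd]
  intro p k hp hk
  have := Fact.mk hp
  rw [← Int.natCast_dvd, padicNorm.dvd_iff_norm_le] at hk ⊢
  exact (h p).trans hk

theorem den_pow_dvd {g : ℤ[X]} (h0 : g.coeff 0 = 0) (hd : 3 ≤ g.natDegree) (c : ℚ) (n : ℕ) :
    (c.den : ℤ) ^ g.natDegree ^ n ∣ g.leadingCoeff ^ g.natDegree ^ n * (Bn g c n : ℤ) ^ 2 := by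
  refine Int.dvd_of_forall_padicNorm_le fun p _ => ?_
  push_cast
  rw [padicNorm.mul, padicNorm_pow, padicNorm_pow, padicNorm_pow]
  have hu0 : 0 ≤ padicNorm p g.leadingCoeff := padicNorm.nonneg _
  have hu : padicNorm p g.leadingCoeff ≤ 1 := padicNorm.of_int _
  have hb0 : 0 ≤ padicNorm p c.den := padicNorm.nonneg _
  have hB0 : 0 ≤ padicNorm p (Bn g c n) := padicNorm.nonneg _
  rcases lt_or_ge (padicNorm p c.den) (padicNorm p g.leadingCoeff) with h | h
  · calc _ ≤ 1 * padicNorm p (Bn g c n) ^ 2 := by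
          gcongr
          exact pow_le_one₀ hu0 hu
      _ ≤ _ := by
          rw [one_mul]
          exact padicNorm_Bn_sq_le p h0 hd h n
  · calc _ ≤ padicNorm p c.den ^ g.natDegree ^ n * 1 := by
          gcongr
          exact pow_le_one₀ hB0 (padicNorm.of_nat _)
      _ = _ := mul_one _

theorem two_pow_le_Bn_sq {g : ℤ[X]} (h0 : g.coeff 0 = 0) (hd : 3 ≤ g.natDegree) {c : ℚ}
    (hc : ¬ (c.den : ℤ) ∣ g.leadingCoeff) (n : ℕ) : 2 ^ g.natDegree ^ n ≤ Bn g c n ^ 2 := by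
  obtain ⟨p, hp, hlt⟩ : ∃ p : ℕ, ∃ _ : Fact p.Prime,
      padicNorm p c.den < padicNorm p g.leadingCoeff := by
    by_contra! h
    refine hc (Int.dvd_of_forall_padicNorm_le fun p hp => ?_)
    exact_mod_cast h p hp
  have hdvd : padicNorm p ((c.den : ℤ) : ℚ) < 1 := by
    push_cast
    exact hlt.trans_le (padicNorm.of_int _)
  rw [padicNorm.int_lt_one_iff] at hdvd
  have h1 : padicNorm p ((c.den : ℤ) : ℚ) ≤ (p : ℚ) ^ (-(1 : ℕ) : ℤ) := by
    rw [← padicNorm.dvd_iff_norm_le, pow_one]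
    exact hdvd
  have h2 : ((p ^ g.natDegree ^ n : ℕ) : ℤ) ∣ (Bn g c n : ℤ) ^ 2 := by
    rw [padicNorm.dvd_iff_norm_le]
    push_cast at h1 ⊢
    rw [padicNorm_pow]
    refine (padicNorm_Bn_sq_le p h0 hd hlt n).trans ?_
    refine (pow_le_pow_left₀ (padicNorm.nonneg _) h1 _).trans (le_of_eq ?_)
    rw [← zpow_natCast, ← zpow_mul]
    congr 1
    push_cast
    ring
  have h3 : p ^ g.natDegree ^ n ≤ Bn g c n ^ 2 := by
    refine Nat.le_of_dvd (pow_pos (Rat.den_pos _) 2) ?_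
    exact_mod_cast h2
  exact (Nat.pow_le_pow_left hp.out.two_le _).trans h3

/-- Lower bound for the denominators in terms of the denominator of `c`. -/
theorem den_pow_le_Bn_pow {g : ℤ[X]} (h0 : g.coeff 0 = 0) (hd : 3 ≤ g.natDegree) {c : ℚ}
    (hc : ¬ (c.den : ℤ) ∣ g.leadingCoeff) {t : ℕ} (ht : g.leadingCoeff.natAbs ≤ 2 ^ t) (n : ℕ) :
    c.den ^ g.natDegree ^ n ≤ Bn g c n ^ (2 * (t + 1)) := by
  have hu : 0 < g.leadingCoeff.natAbs := by
    rw [Int.natAbs_pos, Polynomial.leadingCoeff_ne_zero]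
    rintro rfl
    simp at hd
  have h := Int.natAbs_dvd_natAbs.mpr (den_pow_dvd h0 hd c n)
  simp only [Int.natAbs_mul, Int.natAbs_pow, Int.natAbs_natCast] at h
  have hB : 0 < Bn g c n := Rat.den_pos _
  calc c.den ^ g.natDegree ^ n
      ≤ g.leadingCoeff.natAbs ^ g.natDegree ^ n * Bn g c n ^ 2 := Nat.le_of_dvd (by positivity) h
    _ ≤ (2 ^ t) ^ g.natDegree ^ n * Bn g c n ^ 2 := by gcongr
    _ = (2 ^ g.natDegree ^ n) ^ t * Bn g c n ^ 2 := by rw [← pow_mul, mul_comm t, pow_mul]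
    _ ≤ (Bn g c n ^ 2) ^ t * Bn g c n ^ 2 := by
        gcongr ?_ ^ t * _
        exact two_pow_le_Bn_sq h0 hd hc n
    _ = _ := by ring

theorem exists_int_eq_gcIter_mul {g : ℤ[X]} (h0 : g.coeff 0 = 0) (hd : g.natDegree ≠ 0) (c : ℚ)
    (n : ℕ) : ∃ m : ℤ, gcIter g c (n + 1) = m / (c.den : ℚ) ^ g.natDegree ^ n := by
  have hb : (c.den : ℚ) ≠ 0 := by exact_mod_cast c.den_nz
  induction n with
  | zero =>
    refine ⟨c.num, ?_⟩
    rw [zero_add, gcIter_one h0, pow_zero, pow_one, Rat.num_div_den]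
  | succ n ih =>
    obtain ⟨m, hm⟩ := ih
    obtain ⟨D, bi, h1, h2⟩ := denomsClearable_natDegree (b := (c.den : ℤ) ^ g.natDegree ^ n)
      (bi := ((c.den : ℚ) ^ g.natDegree ^ n)⁻¹) (Int.castRingHom ℚ) g m (by simp [hb])
    have hbi : bi = ((c.den : ℚ) ^ g.natDegree ^ n)⁻¹ := by
      refine eq_inv_of_mul_eq_one_left ?_
      simpa using h1
    rw [hbi] at h2
    simp only [eq_intCast, Int.cast_pow, Int.cast_natCast, ← div_eq_mul_inv, ← hm] at h2
    obtain ⟨e, he⟩ := Nat.exists_eq_succ_of_ne_zero (pow_ne_zero (n + 1) hd)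
    refine ⟨D + c.num * (c.den : ℤ) ^ e, ?_⟩
    rw [gcIter_succ, eq_div_iff (pow_ne_zero _ hb), add_mul]
    push_cast
    rw [h2, ← pow_mul, ← pow_succ, mul_comm, add_right_inj, he, Nat.succ_eq_add_one, pow_succ',
      ← mul_assoc, Rat.mul_den_eq_num]

theorem Bn_le_den_pow {g : ℤ[X]} (h0 : g.coeff 0 = 0) (hd : g.natDegree ≠ 0) (c : ℚ) (n : ℕ) :
    Bn g c n ≤ c.den ^ g.natDegree ^ n := by
  obtain ⟨m, hm⟩ := exists_int_eq_gcIter_mul h0 hd c n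
  refine Nat.le_of_dvd (pow_pos c.den_pos _) ?_
  have := Rat.den_dvd m ((c.den : ℤ) ^ g.natDegree ^ n)
  rw [Rat.divInt_eq_div] at this
  push_cast at this
  rw [← hm] at this
  exact_mod_cast this

theorem abs_An_eq (g : ℤ[X]) (c : ℚ) (n : ℕ) :
    |(An g c n : ℚ)| = |gcIter g c (n + 1)| * Bn g c n := by
  rw [An, Bn, ← Rat.mul_den_eq_num, abs_mul, Nat.abs_cast]

theorem Polynomial.exists_abs_eval_sub_le (P : ℚ[X]) {R : ℚ} (hR : 0 ≤ R) :
    ∃ K, ∀ x y : ℚ, |x| ≤ R → |y| ≤ R → |P.eval x - P.eval y| ≤ K * |x - y| := by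
  induction P using Polynomial.induction_on with
  | C a => exact ⟨0, by simp⟩
  | add p q hp hq =>
    obtain ⟨K₁, h₁⟩ := hp
    obtain ⟨K₂, h₂⟩ := hq
    refine ⟨K₁ + K₂, fun x y hx hy => ?_⟩
    rw [eval_add, eval_add, add_sub_add_comm, add_mul]
    exact (abs_add_le _ _).trans (add_le_add (h₁ x y hx hy) (h₂ x y hx hy))
  | monomial n a ih =>
    obtain ⟨K, h⟩ := ih
    refine ⟨R * K + |a| * R ^ n, fun x y hx hy => ?_⟩
    have h := h x y hx hy
    simp only [eval_mul, eval_C, eval_pow, eval_X] at h ⊢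
    calc |a * x ^ (n + 1) - a * y ^ (n + 1)|
        = |x * (a * x ^ n - a * y ^ n) + a * y ^ n * (x - y)| := by ring_nf
      _ ≤ |x| * |a * x ^ n - a * y ^ n| + |a| * |y| ^ n * |x - y| := by
        refine (abs_add_le _ _).trans (le_of_eq ?_)
        simp only [abs_mul, abs_pow]
      _ ≤ R * (K * |x - y|) + |a| * R ^ n * |x - y| := by gcongr
      _ = _ := by ring

theorem Polynomial.exists_abs_eval_le (P : ℚ[X]) {R : ℚ} (hR : 0 ≤ R) :
    ∃ K, 0 ≤ K ∧ ∀ x : ℚ, |x| ≤ R → |P.eval x| ≤ K := by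
  obtain ⟨K, hK⟩ := P.exists_abs_eval_sub_le hR
  refine ⟨|K| * R + |P.eval 0|, by positivity, fun x hx => ?_⟩
  have h := hK x 0 hx (by simpa using hR)
  have h1 : K * |x - 0| ≤ |K| * R := by
    rw [sub_zero]
    exact mul_le_mul (le_abs_self K) hx (abs_nonneg x) (abs_nonneg K)
  have h2 := abs_sub_abs_le_abs_sub (P.eval x) (P.eval 0)
  linarith

theorem exists_abs_eval_le_sq {g : ℤ[X]} (h0 : g.coeff 0 = 0) (h1 : g.coeff 1 = 0) :
    ∃ K, 0 ≤ K ∧ ∀ x : ℚ, |x| ≤ 1 → |(g.map (Int.castRingHom ℚ)).eval x| ≤ K * x ^ 2 := by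
  obtain ⟨h, hh⟩ : (X : ℚ[X]) ^ 2 ∣ g.map (Int.castRingHom ℚ) := by
    rw [Polynomial.X_pow_dvd_iff]
    intro i hi
    interval_cases i <;> simp [h0, h1]
  obtain ⟨K, hK0, hK⟩ := h.exists_abs_eval_le zero_le_one
  refine ⟨K, hK0, fun x hx => ?_⟩
  rw [hh, Polynomial.eval_mul, abs_mul, mul_comm]
  simp only [Polynomial.eval_pow, Polynomial.eval_X, abs_pow, sq_abs]
  gcongr
  exact hK x hx

/-- Upper bound for the lower order terms outside the unit disc. -/
theorem abs_sum_coeff_mul_pow_le (g : ℤ[X]) {e m : ℕ} (hm : m ≤ e + 1) {x : ℚ} (hx : 1 ≤ |x|) :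
    |∑ i ∈ Finset.range m, (g.coeff i : ℚ) * x ^ i| ≤
      (∑ i ∈ Finset.range m, |(g.coeff i : ℚ)|) * |x| ^ e := by
  rw [Finset.sum_mul]
  refine (Finset.abs_sum_le_sum_abs _ _).trans (Finset.sum_le_sum fun i hi => ?_)
  rw [abs_mul, abs_pow]
  have : i ≤ e := by
    have := Finset.mem_range.mp hi
    omega
  gcongr

/-- Escape radius of the maps `g + c`, uniform for `c` bounded. -/
theorem exists_escape_radius {g : ℤ[X]} (hd : 2 ≤ g.natDegree) {M : ℚ} (hM : 0 ≤ M) :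
    ∃ R, 1 ≤ R ∧ ∀ c x : ℚ, |c| ≤ M → R < |x| →
      R < |(g.map (Int.castRingHom ℚ)).eval x + c| := by
  set S := ∑ i ∈ Finset.range g.natDegree, |(g.coeff i : ℚ)| with hS
  have hS0 : 0 ≤ S := Finset.sum_nonneg fun _ _ => abs_nonneg _
  refine ⟨S + M + 1, by linarith, fun c x hc hx => ?_⟩
  have hx1 : 1 ≤ |x| := by linarith
  obtain ⟨e, he⟩ := Nat.exists_eq_add_of_le hd
  have hlc : 1 ≤ |(g.leadingCoeff : ℚ)| := by
    rw [← Int.cast_abs]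
    have : g.leadingCoeff ≠ 0 := by
      rw [Polynomial.leadingCoeff_ne_zero]
      rintro rfl
      simp at hd
    exact_mod_cast Int.one_le_abs this
  have hlow := abs_sum_coeff_mul_pow_le g (e := e + 1) (m := g.natDegree) (by omega) hx1
  have hpow : |x| ≤ |x| ^ (e + 1) := le_self_pow₀ hx1 (by omega)
  have hlead : |x| ^ (e + 1) * |x| ≤ |(g.leadingCoeff : ℚ) * x ^ g.natDegree| := by
    rw [abs_mul, abs_pow, ← pow_succ, he, add_comm 2 e]
    exact le_mul_of_one_le_left (by positivity) hlc
  rw [eval_map_eq_sum]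
  set s := ∑ i ∈ Finset.range g.natDegree, (g.coeff i : ℚ) * x ^ i with hs
  set l := (g.leadingCoeff : ℚ) * x ^ g.natDegree with hl
  have h1 : |l| ≤ |s + l + c| + |s| + |c| := by
    calc |l| = |(s + l + c) - s - c| := by ring_nf
      _ ≤ _ := (abs_sub _ _).trans (add_le_add_left (abs_sub _ _) _)
  nlinarith

theorem exists_abs_gcIter_le {g : ℤ[X]} (h0 : g.coeff 0 = 0) (hd : 2 ≤ g.natDegree) {M : ℚ}
    (hM : 0 ≤ M) : ∃ H, 1 ≤ H ∧ ∀ c : ℚ, |c| ≤ M → ∀ n,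
      |gcIter g c (n + 1)| ≤ H ^ (2 * g.natDegree ^ n) := by
  set S := ∑ i ∈ Finset.range (g.natDegree + 1), |(g.coeff i : ℚ)| with hS
  have hS0 : 0 ≤ S := Finset.sum_nonneg fun _ _ => abs_nonneg _
  have hH : 1 ≤ S + M + 1 := by linarith
  refine ⟨S + M + 1, hH, fun c hc n => ?_⟩
  have key : ∀ y : ℚ, 1 ≤ y → ∀ x : ℚ, |x| ≤ y →
      |(g.map (Int.castRingHom ℚ)).eval x + c| ≤ (S + M + 1) * y ^ g.natDegree := by
    intro y hy x hx
    have h1 : |(g.map (Int.castRingHom ℚ)).eval x| ≤ S * y ^ g.natDegree := by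
      rw [Polynomial.eval_map, Polynomial.eval₂_eq_sum_range, hS, Finset.sum_mul]
      refine (Finset.abs_sum_le_sum_abs _ _).trans (Finset.sum_le_sum fun i hi => ?_)
      rw [abs_mul, abs_pow, eq_intCast]
      have hi' : i ≤ g.natDegree := by
        have := Finset.mem_range.mp hi
        omega
      gcongr
      calc |x| ^ i ≤ y ^ i := by gcongr
        _ ≤ y ^ g.natDegree := by gcongr
    have h2 := abs_add_le ((g.map (Int.castRingHom ℚ)).eval x) c
    have h3 : 1 ≤ y ^ g.natDegree := one_le_pow₀ hy
    nlinarith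
  have hmain : ∀ n, |gcIter g c (n + 1)| ≤ (S + M + 1) ^ (2 * g.natDegree ^ n - 1) := by
    intro n
    induction n with
    | zero => rw [zero_add, gcIter_one h0, pow_zero]; norm_num; linarith
    | succ n ih =>
      rw [gcIter_succ]
      refine (key _ (one_le_pow₀ hH) _ ih).trans ?_
      rw [← pow_mul, ← pow_succ']
      refine pow_le_pow_right₀ hH ?_
      have : 1 ≤ g.natDegree ^ n := Nat.one_le_pow _ _ (by omega)
      rw [Nat.sub_mul, mul_assoc, ← pow_succ, one_mul]
      have : g.natDegree ≤ g.natDegree ^ (n + 1) := Nat.le_self_pow (by omega) _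
      omega
  exact (hmain n).trans (pow_le_pow_right₀ hH (by omega))

/-- The trichotomy of `exists_first_close_return` for the critical orbits of `g + c`, with a
constant uniform for `c` bounded. -/
theorem exists_uniform_first_close_return {g : ℤ[X]} (hg : IsX2Divisible g) {M : ℚ}
    (hM : 0 ≤ M) : ∃ K, 1 ≤ K ∧ ∀ c : ℚ, |c| ≤ M → ∃ k, 1 ≤ k ∧ ∀ n, 1 ≤ n →
      1 / (16 * K ^ n) ≤ |gcIter g c n| ∨ n = k ∨
        (2 * k ≤ n ∧ |gcIter g c k| / 2 ≤ |gcIter g c n|) := by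
  obtain ⟨hd, h0, h1⟩ := hg
  obtain ⟨R, hR, hesc⟩ := exists_escape_radius hd hM
  obtain ⟨K₁, hK₁⟩ := (g.map (Int.castRingHom ℚ)).exists_abs_eval_sub_le
    (R := R + 1) (by linarith)
  obtain ⟨K₂, -, hK₂⟩ := exists_abs_eval_le_sq h0 h1
  refine ⟨max 1 (max K₁ K₂), le_max_left _ _, fun c hc => ?_⟩
  refine exists_first_close_return (fun x => (g.map (Int.castRingHom ℚ)).eval x + c) _ R
    (le_max_left _ _) hR (fun x y hx hy => ?_) (fun x hx => ?_) (fun x hx => hesc c x hc hx)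
    (gcIter g c) rfl (gcIter_succ g c)
  · rw [add_sub_add_right_eq_sub]
    refine (hK₁ x y hx hy).trans ?_
    gcongr
    exact (le_max_left K₁ K₂).trans (le_max_right _ _)
  · have : (g.map (Int.castRingHom ℚ)).eval 0 = 0 := by
      simp [← Polynomial.coeff_zero_eq_eval_zero, h0]
    rw [add_sub_add_right_eq_sub, this, sub_zero]
    refine (hK₂ x hx).trans ?_
    gcongr
    exact (le_max_right K₁ K₂).trans (le_max_right _ _)

theorem mul_succ_lt_three_pow_half (a n : ℕ) (hn : 4 * a + 4 ≤ n) : a * (n + 1) < 3 ^ (n / 2) := by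
  have key : ∀ m, 2 ≤ m → (m + 1) ^ 2 ≤ 3 ^ m := by
    intro m hm
    induction m, hm using Nat.le_induction with
    | base => norm_num
    | succ m hm ih => rw [pow_succ 3]; nlinarith
  have h1 := key (n / 2) (by omega)
  have h2 : n + 1 ≤ 2 * (n / 2 + 1) := by omega
  have h3 : 2 * a < n / 2 + 1 := by omega
  nlinarith

/-- Up to a uniformly bounded number of indices, the numerators are at least the square roots of
the denominators. -/
theorem exists_Bn_le_An_sq {g : ℤ[X]} (hg : IsX2Divisible g) (hd : 3 ≤ g.natDegree) {M : ℚ}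
    (hM : 0 ≤ M) : ∃ N, ∀ c : ℚ, |c| ≤ M → ¬ (c.den : ℤ) ∣ g.leadingCoeff →
      ∃ k, ∀ n, N ≤ n → n ≠ k → (Bn g c n : ℤ) ≤ An g c n ^ 2 := by
  have h0 := hg.2.1
  obtain ⟨K, hK1, hK⟩ := exists_uniform_first_close_return hg hM
  obtain ⟨t, ht⟩ : ∃ t, g.leadingCoeff.natAbs ≤ 2 ^ t := ⟨_, Nat.lt_two_pow_self.le⟩
  obtain ⟨κ, hκ⟩ : ∃ κ : ℕ, K ≤ 2 ^ κ := by
    obtain ⟨m, hm⟩ := exists_nat_ge K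
    exact ⟨m, hm.trans (by exact_mod_cast Nat.lt_two_pow_self.le)⟩
  set T := 2 * (t + 1) with hT
  set a := 16 + 4 * κ + 4 * T with ha
  refine ⟨4 * a + 4, fun c hc hden => ?_⟩
  obtain ⟨k, hk1, hk⟩ := hK c hc
  refine ⟨k - 1, fun n hn hnk => ?_⟩
  have hgrow := mul_succ_lt_three_pow_half a n hn
  have hdn : 3 ^ (n / 2) ≤ g.natDegree ^ (n / 2) := Nat.pow_le_pow_left hd _
  have hB0 : (0 : ℚ) < Bn g c n := by exact_mod_cast Rat.den_pos _
  suffices h : 1 ≤ gcIter g c (n + 1) ^ 2 * Bn g c n by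
    have hA := abs_An_eq g c n
    have : (Bn g c n : ℚ) ≤ (An g c n : ℚ) ^ 2 := by
      rw [← sq_abs, hA, mul_pow, sq_abs]
      nlinarith
    exact_mod_cast this
  rcases hk (n + 1) (by omega) with h | h | ⟨h, h'⟩
  · have hpos : 0 < 16 * K ^ (n + 1) := by positivity
    have h1 : 16 * K ^ (n + 1) ≤ 2 ^ (4 + κ * (n + 1)) := by
      calc 16 * K ^ (n + 1) ≤ 2 ^ 4 * (2 ^ κ) ^ (n + 1) := by
            gcongr
            norm_num
        _ = _ := by rw [← pow_mul, ← pow_add]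
    have h2 : (2 : ℚ) ^ ((4 + κ * (n + 1)) * 2) ≤ Bn g c n := by
      have h3 : 2 ^ g.natDegree ^ n ≤ Bn g c n ^ 2 := two_pow_le_Bn_sq h0 hd hden n
      have h4 : (4 + κ * (n + 1)) * 2 * 2 ≤ g.natDegree ^ n := by
        have : g.natDegree ^ (n / 2) ≤ g.natDegree ^ n :=
          Nat.pow_le_pow_right (by omega) (Nat.div_le_self _ _)
        nlinarith
      have h5 : (2 ^ ((4 + κ * (n + 1)) * 2)) ^ 2 ≤ Bn g c n ^ 2 := by
        rw [← pow_mul]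
        exact (Nat.pow_le_pow_right two_pos h4).trans h3
      exact_mod_cast (Nat.pow_le_pow_iff_left two_ne_zero).mp h5
    rw [← sq_abs]
    calc (1 : ℚ) = (1 / (16 * K ^ (n + 1))) ^ 2 * (16 * K ^ (n + 1)) ^ 2 := by
          field_simp
      _ ≤ |gcIter g c (n + 1)| ^ 2 * Bn g c n := by
          gcongr
          refine le_trans ?_ h2
          rw [pow_mul]
          gcongr
  · omega
  · obtain ⟨m, rfl⟩ := Nat.exists_eq_succ_of_ne_zero (by omega : k ≠ 0)
    rw [Nat.succ_eq_add_one] at *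
    have hBm0 : (0 : ℚ) < Bn g c m := by exact_mod_cast Rat.den_pos _
    have hb2 : 2 ≤ c.den := by
      have := c.den_pos
      rcases Nat.lt_or_ge c.den 2 with hlt | hge
      · refine absurd ?_ hden
        rw [show c.den = 1 by omega]
        simp
      · exact hge
    have hAm : 1 ≤ |gcIter g c (m + 1)| * Bn g c m := by
      rw [← abs_An_eq, ← Int.cast_abs]
      have : An g c m ≠ 0 := by
        intro h
        have h1 : Bn g c m = 1 := by
          rw [An, Rat.num_eq_zero] at h
          rw [Bn, h, Rat.den_zero]
        have h2 := two_pow_le_Bn_sq h0 hd hden m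
        rw [h1, one_pow] at h2
        have := Nat.one_lt_two_pow (n := g.natDegree ^ m) (pow_ne_zero _ (by omega))
        omega
      exact_mod_cast Int.one_le_abs this
    have hBB : 4 * Bn g c m ^ 2 ≤ Bn g c n := by
      have h1 : (4 * Bn g c m ^ 2) ^ T ≤ Bn g c n ^ T := by
        refine le_trans ?_ (den_pow_le_Bn_pow h0 hd hden ht n)
        calc (4 * Bn g c m ^ 2) ^ T ≤ (c.den ^ 2 * (c.den ^ g.natDegree ^ m) ^ 2) ^ T := by
              gcongr
              · nlinarith
              · exact Bn_le_den_pow h0 (by omega) c m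
          _ = c.den ^ ((2 + g.natDegree ^ m * 2) * T) := by
              rw [← pow_mul, ← pow_add, ← pow_mul]
          _ ≤ c.den ^ g.natDegree ^ n := by
              refine Nat.pow_le_pow_right (by omega) ?_
              have h2 : g.natDegree ^ (n / 2) * g.natDegree ^ m ≤ g.natDegree ^ n := by
                rw [← pow_add]
                exact Nat.pow_le_pow_right (by omega) (by omega)
              have h3 : 1 ≤ g.natDegree ^ m := Nat.one_le_pow _ _ (by omega)
              have h4 : 4 * T ≤ g.natDegree ^ (n / 2) := by nlinarith
              calc (2 + g.natDegree ^ m * 2) * T ≤ 4 * T * g.natDegree ^ m := by nlinarith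
                _ ≤ g.natDegree ^ (n / 2) * g.natDegree ^ m := by gcongr
                _ ≤ _ := h2
      exact (Nat.pow_le_pow_iff_left (by omega)).mp h1
    have hBB' : 4 * (Bn g c m : ℚ) ^ 2 ≤ Bn g c n := by exact_mod_cast hBB
    rw [← sq_abs]
    calc (1 : ℚ) ≤ (|gcIter g c (m + 1)| * Bn g c m) ^ 2 := one_le_pow₀ hAm
      _ = (|gcIter g c (m + 1)| / 2) ^ 2 * (4 * (Bn g c m : ℚ) ^ 2) := by ring
      _ ≤ _ := by gcongr

/-- The critical orbits of `g + c` have rapidly increasing numerators, uniformly for `c` bounded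
with denominator not dividing the leading coefficient of `g`. -/
theorem rapidlyIncreasingNumerators_of_bounded {g : ℤ[X]} (hg : IsX2Divisible g)
    (hd : 3 ≤ g.natDegree) {M : ℚ} (hM : 0 ≤ M) :
    RapidlyIncreasingNumerators g {c | |c| ≤ M ∧ ¬ (c.den : ℤ) ∣ g.leadingCoeff} := by
  have h0 := hg.2.1
  obtain ⟨N₁, hN₁⟩ := exists_Bn_le_An_sq hg hd hM
  obtain ⟨H, hH1, hH⟩ := exists_abs_gcIter_le h0 hg.1 hM
  obtain ⟨t, ht⟩ : ∃ t, g.leadingCoeff.natAbs ≤ 2 ^ t := ⟨_, Nat.lt_two_pow_self.le⟩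
  obtain ⟨h, hh⟩ : ∃ h : ℕ, H ≤ 2 ^ h := by
    obtain ⟨m, hm⟩ := exists_nat_ge H
    exact ⟨m, hm.trans (by exact_mod_cast Nat.lt_two_pow_self.le)⟩
  set T := 2 * (t + 1) with hT
  set E := h * 2 + 1 with hE
  set N := max N₁ (4 * (2 * T * E) + 4) with hN
  refine ⟨N + 1, by omega, fun c ⟨hcM, hden⟩ => ?_⟩
  obtain ⟨k, hk⟩ := hN₁ c hcM hden
  refine ⟨insert k (Finset.range N), (Finset.card_insert_le _ _).trans (by simp), ?_⟩
  intro n hn1 hnJ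
  rw [Finset.mem_insert, Finset.mem_range, not_or, not_lt] at hnJ
  obtain ⟨hnk, hnN⟩ := hnJ
  have hsq := hk n ((le_max_left _ _).trans hnN) hnk
  have hgrow := mul_succ_lt_three_pow_half (2 * T * E) n ((le_max_right _ _).trans hnN)
  have hb2 : 2 ≤ c.den := by
    have := c.den_pos
    rcases Nat.lt_or_ge c.den 2 with hlt | hge
    · refine absurd ?_ hden
      rw [show c.den = 1 by omega]
      simp
    · exact hge
  set β := Real.log c.den with hβ
  have hβ0 : 0 < β := Real.log_pos (by exact_mod_cast hb2)
  have hB0 : (0 : ℝ) < Bn g c n := by exact_mod_cast Rat.den_pos _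
  have hlower : (g.natDegree : ℝ) ^ n * β ≤ 2 * T * Real.log |(An g c n : ℝ)| := by
    have h1 : (g.natDegree : ℝ) ^ n * β ≤ T * Real.log (Bn g c n) := by
      have h2 := den_pow_le_Bn_pow h0 hd hden ht n
      have h3 : (c.den : ℝ) ^ g.natDegree ^ n ≤ (Bn g c n : ℝ) ^ T := by exact_mod_cast h2
      have h4 := Real.log_le_log (by have := c.den_pos; positivity) h3
      rw [Real.log_pow, Real.log_pow] at h4
      exact_mod_cast h4
    have h5 : Real.log (Bn g c n) ≤ 2 * Real.log |(An g c n : ℝ)| := by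
      have h6 : (Bn g c n : ℝ) ≤ |(An g c n : ℝ)| ^ 2 := by
        rw [sq_abs]
        exact_mod_cast hsq
      have h7 := Real.log_le_log hB0 h6
      rw [Real.log_pow] at h7
      exact_mod_cast h7
    nlinarith [(Nat.cast_nonneg T : (0 : ℝ) ≤ T)]
  have hupper : ∀ m, m ≤ n / 2 →
      Real.log |(An g c m : ℝ)| ≤ E * (g.natDegree : ℝ) ^ (n / 2) * β := by
    intro m hm
    by_cases hA : An g c m = 0
    · rw [hA]
      simp only [Int.cast_zero, abs_zero, Real.log_zero]
      positivity
    have h1 : |(An g c m : ℚ)| ≤ (c.den : ℚ) ^ (E * g.natDegree ^ m) := by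
      rw [abs_An_eq]
      have hBm : (Bn g c m : ℚ) ≤ (c.den : ℚ) ^ g.natDegree ^ m := by
        exact_mod_cast Bn_le_den_pow h0 (by omega) c m
      have hb2' : (2 : ℚ) ≤ c.den := by exact_mod_cast hb2
      calc |gcIter g c (m + 1)| * Bn g c m
          ≤ ((c.den : ℚ) ^ h) ^ (2 * g.natDegree ^ m) * (c.den : ℚ) ^ g.natDegree ^ m := by
            gcongr
            refine (hH c hcM m).trans ?_
            gcongr
            exact hh.trans (by gcongr)
        _ = _ := by
            rw [← pow_mul, ← pow_add]
            congr 1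
            rw [hE]
            ring
    have h2 : |(An g c m : ℝ)| ≤ (c.den : ℝ) ^ (E * g.natDegree ^ m) := by exact_mod_cast h1
    have h3 := Real.log_le_log (by positivity) h2
    rw [Real.log_pow] at h3
    refine h3.trans ?_
    push_cast
    gcongr
    have : (3 : ℝ) ≤ g.natDegree := by exact_mod_cast hd
    linarith
  have hsum : ∑ p ∈ n.primeFactors, Real.log |(An g c (n / p) : ℝ)| ≤
      n * (E * (g.natDegree : ℝ) ^ (n / 2) * β) := by
    refine (Finset.sum_le_card_nsmul _ _ _ fun p hp => hupper (n / p)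
      (Nat.div_le_div_left (Nat.prime_of_mem_primeFactors hp).two_le two_pos)).trans ?_
    rw [nsmul_eq_mul]
    gcongr
    calc n.primeFactors.card ≤ (Finset.Icc 1 n).card := by
          refine Finset.card_le_card fun p hp => Finset.mem_Icc.mpr ?_
          exact ⟨(Nat.prime_of_mem_primeFactors hp).one_le, Nat.le_of_mem_primeFactors hp⟩
      _ = n := by simp
  have hd2 : 2 * T * E * n * g.natDegree ^ (n / 2) < g.natDegree ^ n := by
    have h1 : 3 ^ (n / 2) ≤ g.natDegree ^ (n / 2) := Nat.pow_le_pow_left hd _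
    have h2 : g.natDegree ^ (n / 2) * g.natDegree ^ (n / 2) ≤ g.natDegree ^ n := by
      rw [← pow_add]
      exact Nat.pow_le_pow_right (by omega) (by omega)
    have h3 : 0 < g.natDegree ^ (n / 2) := by positivity
    refine lt_of_lt_of_le ?_ h2
    gcongr
    nlinarith
  have hd2' : 2 * T * E * n * (g.natDegree : ℝ) ^ (n / 2) < (g.natDegree : ℝ) ^ n := by
    exact_mod_cast hd2
  have hT0 : (0 : ℝ) < 2 * T := by
    rw [hT]
    positivity
  refine hsum.trans_lt (lt_of_mul_lt_mul_left (lt_of_lt_of_le ?_ hlower) hT0.le)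
  calc 2 * T * (n * (E * (g.natDegree : ℝ) ^ (n / 2) * β))
      = 2 * T * E * n * (g.natDegree : ℝ) ^ (n / 2) * β := by ring
    _ < _ := by gcongr

/-- Proposition 3.7: for `g` `x²`-divisible of degree `d ≥ 3` and `α ∈ [−4L_g, 4L_g]`
with `g ≠ u_d x^d` or `α ≠ 0`, there is `0 < δ < L_g` such that `g` has rapidly
increasing numerators on `(α−δ, α+δ) ∩ 𝕌_g`. -/
theorem rapidly_increasing_numerators_near_alpha (g : ℤ[X]) (hg : IsX2Divisible g)
    (hd : 3 ≤ g.natDegree) (α : ℝ) (hα : α ∈ Set.Icc (-(4 * Lg g)) (4 * Lg g))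
    (hne : g ≠ Polynomial.C g.leadingCoeff * Polynomial.X ^ g.natDegree ∨ α ≠ 0) :
    ∃ δ : ℝ, 0 < δ ∧ δ < Lg g ∧
      RapidlyIncreasingNumerators g
        ({c : ℚ | (c : ℝ) ∈ Set.Ioo (α - δ) (α + δ)} ∩ Ug g) := by
  have hL : 1 ≤ Lg g := by
    rw [Lg, le_add_iff_nonneg_right]
    positivity
  obtain ⟨M, hM⟩ := exists_nat_ge (4 * Lg g)
  obtain ⟨N, hN, h⟩ := rapidlyIncreasingNumerators_of_bounded hg hd (M := M) (by positivity)
  refine ⟨1 / 2, by norm_num, by linarith, N, hN, fun c hc => h c ⟨?_, fun hdvd => ?_⟩⟩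
  · have : |(c : ℝ)| ≤ M := hc.2.1.trans hM
    exact_mod_cast this
  · exact hc.2.2.2 ⟨hc.2.2.1, hc.2.1, hdvd⟩
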